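/- arXiv:1502.04898 — 2 statements merged into one kernel-verified Lean document; each statement's English description precedes it below -/
import Mathlib

section
/- Let T be a monad on the category of sets, let Γ be a finite alphabet, let L ⊆ T Γ be a recognisable language with syntactic morphism f : T Γ → B, and let Σ be a finite alphabet. Then every syntactic derivative of L over Σ is a preimage, under a T-morphism of free algebras, of a Boolean combination of polynomial derivatives of L: if K ⊆ T Σ satisfies K = h⁻¹(F) for some T-morphism h : T Σ → B into the syntactic algebra B and some F ⊆ B, then there exist a T-morphism g : T Σ → T Γ and a set M ⊆ T Γ which is a Boolean combination of finitely many polynomial derivatives of L, such that K = g⁻¹(M). -/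
universe u

structure SetMonad : Type (u + 1) where
  T : Type u → Type u
  map : {X Y : Type u} → (X → Y) → T X → T Y
  unit : {X : Type u} → X → T X
  mult : {X : Type u} → T (T X) → T X
  map_id : ∀ {X : Type u} (w : T X), map id w = w
  map_comp : ∀ {X Y Z : Type u} (g : Y → Z) (f : X → Y) (w : T X),
    map (g ∘ f) w = map g (map f w)
  unit_nat : ∀ {X Y : Type u} (f : X → Y) (x : X), map f (unit x) = unit (f x)
  mult_nat : ∀ {X Y : Type u} (f : X → Y) (w : T (T X)),
    map f (mult w) = mult (map (map f) w)
  mult_unit : ∀ {X : Type u} (w : T X), mult (unit w) = w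
  mult_map_unit : ∀ {X : Type u} (w : T X), mult (map unit w) = w
  mult_assoc : ∀ {X : Type u} (w : T (T (T X))), mult (mult w) = mult (map mult w)

structure SetMonad.Alg (M : SetMonad.{u}) : Type (u + 1) where
  carrier : Type u
  mul : M.T carrier → carrier
  mul_unit : ∀ a, mul (M.unit a) = a
  mul_assoc : ∀ w, mul (M.mult w) = mul (M.map mul w)

namespace SetMonad

variable (M : SetMonad.{u})

/-- `h` is a morphism of Eilenberg–Moore `T`-algebras. -/
def IsHom (A B : M.Alg) (h : A.carrier → B.carrier) : Prop :=
  ∀ w, h (A.mul w) = B.mul (M.map h w)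

/-- The free `T`-algebra on a set. -/
def Free (Sig : Type u) : M.Alg where
  carrier := M.T Sig
  mul := M.mult
  mul_unit := M.mult_unit
  mul_assoc := M.mult_assoc

/-- Unary polynomials over an algebra: elements of `T (A ⊕ {x})`. -/
def UPoly (A : M.Alg) : Type u := M.T (A.carrier ⊕ PUnit.{u + 1})

/-- Evaluation of a unary polynomial at a point. -/
def evalPoly (A : M.Alg) (p : M.UPoly A) (a : A.carrier) : A.carrier :=
  A.mul (M.map (Sum.elim id fun _ => a) p)

/-- Polynomial derivative of a language. -/
def deriv {Sig : Type u} (p : M.UPoly (M.Free Sig)) (L : Set (M.T Sig)) : Set (M.T Sig) :=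
  {w | M.evalPoly (M.Free Sig) p w ∈ L}

/-- A language is recognisable if it is a morphism preimage from a finite algebra. -/
def Recognisable (A : M.Alg) (L : Set A.carrier) : Prop :=
  ∃ (B : M.Alg) (h : A.carrier → B.carrier) (F : Set B.carrier),
    Finite B.carrier ∧ M.IsHom A B h ∧ L = h ⁻¹' F

/-- `h` is a syntactic morphism of `L`. -/
def IsSynMorphism {Sig : Type u} (L : Set (M.T Sig)) (B : M.Alg)
    (h : M.T Sig → B.carrier) : Prop :=
  Finite B.carrier ∧ M.IsHom (M.Free Sig) B h ∧ Function.Surjective h ∧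
    ∀ w w' : M.T Sig, h w = h w' ↔
      ∀ p : M.UPoly (M.Free Sig),
        (M.evalPoly (M.Free Sig) p w ∈ L ↔ M.evalPoly (M.Free Sig) p w' ∈ L)

end SetMonad

/-- `BoolComb S s` says that `s` belongs to the Boolean algebra of sets generated by the
family `S`. -/
inductive BoolComb {α : Type*} (S : Set (Set α)) : Set α → Prop
  | base (s : Set α) (hs : s ∈ S) : BoolComb S s
  | univ : BoolComb S Set.univ
  | compl (s : Set α) : BoolComb S s → BoolComb S sᶜ
  | union (s t : Set α) : BoolComb S s → BoolComb S t → BoolComb S (s ∪ t)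

theorem BoolComb.empty {α : Type*} {S : Set (Set α)} : BoolComb S ∅ := by
  simpa using BoolComb.compl _ (BoolComb.univ (S := S))

theorem BoolComb.sUnion {α : Type*} {S C : Set (Set α)} (hC : C.Finite)
    (h : ∀ s ∈ C, BoolComb S s) : BoolComb S (⋃₀ C) := by
  induction C, hC using Set.Finite.induction_on with
  | empty => simpa using BoolComb.empty
  | insert _ _ ih =>
    rw [Set.sUnion_insert]
    exact .union _ _ (h _ (Set.mem_insert _ _)) (ih fun s hs => h s (Set.mem_insert_of_mem _ hs))

theorem BoolComb.sInter {α : Type*} {S C : Set (Set α)} (hC : C.Finite)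
    (h : ∀ s ∈ C, BoolComb S s) : BoolComb S (⋂₀ C) := by
  rw [Set.sInter_eq_compl_sUnion_compl]
  refine .compl _ (.sUnion (hC.image _) ?_)
  rintro _ ⟨s, hs, rfl⟩
  exact .compl _ (h s hs)

/-- A set that does not separate points lying in the same members of a finite family `S`
is a Boolean combination of members of `S`. -/
theorem BoolComb.of_saturated {α : Type*} {S : Set (Set α)} (hS : S.Finite) {A : Set α}
    (hA : ∀ x y, (∀ s ∈ S, x ∈ s ↔ y ∈ s) → x ∈ A → y ∈ A) : BoolComb S A := by
  let atom : Set (Set α) → Set α := fun t => ⋂₀ t ∩ ⋂₀ ((·ᶜ) '' (S \ t))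
  let members : α → Set (Set α) := fun x => {s ∈ S | x ∈ s}
  have hmem : ∀ x y, y ∈ atom (members x) ↔ ∀ s ∈ S, x ∈ s ↔ y ∈ s := by
    intro x y
    simp only [atom, members, Set.mem_inter_iff, Set.mem_sInter, Set.mem_image, Set.mem_sdiff,
      Set.mem_ofPred_eq, forall_exists_index, and_imp]
    grind
  have hAeq : A = ⋃₀ (atom '' (members '' A)) := by
    ext y
    simp only [Set.mem_sUnion, Set.exists_mem_image, hmem]
    exact ⟨fun hy => ⟨y, hy, fun _ _ => Iff.rfl⟩, fun ⟨x, hx, hxy⟩ => hA x y hxy hx⟩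
  rw [hAeq]
  have hsub : members '' A ⊆ 𝒫 S := by
    rintro _ ⟨x, _, rfl⟩
    exact Set.sep_subset _ _
  refine .sUnion ((hS.powerset.subset hsub).image _) ?_
  rintro _ ⟨t, ht, rfl⟩
  have htS : t ⊆ S := hsub ht
  rw [show atom t = ⋂₀ (t ∪ (·ᶜ) '' (S \ t)) from (Set.sInter_union _ _).symm]
  refine .sInter ((hS.subset htS).union (hS.sdiff.image _)) ?_
  rintro s (hs | ⟨r, hr, rfl⟩)
  · exact .base _ (htS hs)
  · exact .compl _ (.base _ hr.1)

namespace SetMonad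

/-- Free algebras are projective: a morphism out of one lifts along a surjective morphism. -/
theorem exists_lift (M : SetMonad.{u}) {Sig : Type u} {A B : M.Alg}
    {f : A.carrier → B.carrier} (hf : M.IsHom A B f) (hsurj : Function.Surjective f)
    {h : M.T Sig → B.carrier} (hh : M.IsHom (M.Free Sig) B h) :
    ∃ g : M.T Sig → A.carrier, M.IsHom (M.Free Sig) A g ∧ ∀ w, f (g w) = h w := by
  choose γ hγ using fun a : Sig => hsurj (h (M.unit a))
  refine ⟨fun w => A.mul (M.map γ w), fun (w : M.T (M.T Sig)) => ?_, fun w => ?_⟩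
  · change A.mul (M.map γ (M.mult w)) = A.mul (M.map (A.mul ∘ M.map γ) w)
    rw [M.mult_nat, A.mul_assoc, M.map_comp]
  · rw [hf, ← M.map_comp, show f ∘ γ = h ∘ M.unit from funext hγ, M.map_comp]
    exact (hh (M.map M.unit w)).symm.trans (congrArg h (M.mult_map_unit w))

/-- Finitely many polynomial derivatives separate the fibres of a syntactic morphism. -/
theorem IsSynMorphism.exists_finite_separating {M : SetMonad.{u}} {Sig : Type u}
    {L : Set (M.T Sig)} {B : M.Alg} {f : M.T Sig → B.carrier} (hf : M.IsSynMorphism L B f) :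
    ∃ P : Set (M.UPoly (M.Free Sig)), P.Finite ∧
      ∀ w w', (∀ p ∈ P, w ∈ M.deriv p L ↔ w' ∈ M.deriv p L) → f w = f w' := by
  obtain ⟨hfin, -, hsurj, hker⟩ := hf
  have hsep : ∀ q : {q : B.carrier × B.carrier // q.1 ≠ q.2},
      ∃ p : M.UPoly (M.Free Sig), ∀ w w', f w = q.1.1 → f w' = q.1.2 →
        ¬(w ∈ M.deriv p L ↔ w' ∈ M.deriv p L) := by
    rintro ⟨⟨b, b'⟩, hne⟩
    obtain ⟨v, rfl⟩ := hsurj b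
    obtain ⟨v', rfl⟩ := hsurj b'
    obtain ⟨p, hp⟩ := not_forall.mp (mt (hker v v').mpr hne)
    refine ⟨p, fun w w' hw hw' hww' => hp ?_⟩
    exact ((hker w v).mp hw p).symm.trans (hww'.trans ((hker w' v').mp hw' p))
  choose p hp using hsep
  refine ⟨Set.range p, Set.finite_range p, fun w w' hww' => ?_⟩
  by_contra hne
  exact hp ⟨(f w, f w'), hne⟩ w w' rfl rfl (hww' _ ⟨_, rfl⟩)

end SetMonad

/-- Every syntactic derivative of `L` is a preimage, under a `T`-morphism of free
algebras, of a Boolean combination of polynomial derivatives of `L`. -/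
theorem syntactic_derivative_is_preimage_of_boolean_combination (M : SetMonad.{u})
    (Gam : Type u) (hGam : Finite Gam) (L : Set (M.T Gam))
    (hrec : M.Recognisable (M.Free Gam) L)
    (B : M.Alg) (f : M.T Gam → B.carrier) (hsyn : M.IsSynMorphism L B f)
    (Sig : Type u) (hSig : Finite Sig) (K : Set (M.T Sig))
    (h : M.T Sig → B.carrier) (hh : M.IsHom (M.Free Sig) B h) (F : Set B.carrier)
    (hK : K = h ⁻¹' F) :
    ∃ (g : M.T Sig → M.T Gam) (Mset : Set (M.T Gam)),
      M.IsHom (M.Free Sig) (M.Free Gam) g ∧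
      (∃ P : Set (M.UPoly (M.Free Gam)), P.Finite ∧
        BoolComb {s : Set (M.T Gam) | ∃ p ∈ P, s = M.deriv p L} Mset) ∧
      K = g ⁻¹' Mset := by
  obtain ⟨g, hg, hfg⟩ := M.exists_lift (A := M.Free Gam) hsyn.2.1 hsyn.2.2.1 hh
  obtain ⟨P, hP, hsep⟩ := hsyn.exists_finite_separating
  refine ⟨g, f ⁻¹' F, hg, ⟨P, hP, .of_saturated ?_ fun x y hxy hx => ?_⟩, ?_⟩
  · refine (hP.image fun p => M.deriv p L).subset ?_
    rintro _ ⟨p, hp, rfl⟩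
    exact ⟨p, hp, rfl⟩
  · have hfxy : f x = f y := hsep x y fun p hp => hxy _ ⟨p, hp, rfl⟩
    exact (congrArg (· ∈ F) hfxy).mp hx
  · subst hK
    ext w
    exact (congrArg (· ∈ F) (hfg w)).to_iff.symm
end

section
/- Let T be a monad on the category of sets, let A be a T-algebra, and equip its compactification Ā with the topology generated by the sets h̄⁻¹({b}) for h : A → B a T-morphism into a finite T-algebra of the skeleton and b ∈ B. Then a subset of Ā is clopen if and only if it equals the closure in Ā of ι_A(L) for some recognisable subset L of A (i.e. L = h⁻¹(F) for some T-morphism h from A into a finite T-algebra of the skeleton and some F). -/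
universe u

namespace SetMonad

variable (M : SetMonad.{u})

variable {M}

theorem isHom_comp {A B C : M.Alg} {h : A.carrier → B.carrier}
    {g : B.carrier → C.carrier} (hh : M.IsHom A B h) (hg : M.IsHom B C g) :
    M.IsHom A C (g ∘ h) := by
  intro w
  show g (h (A.mul w)) = C.mul (M.map (g ∘ h) w)
  rw [hh w, hg, M.map_comp]

theorem mapIsHom {Gam Sig : Type u} (f : Gam → Sig) :
    M.IsHom (M.Free Gam) (M.Free Sig) (M.map f) :=
  fun w => M.mult_nat f w

variable (M)

/-- The finite `T`-algebras of the chosen skeleton: algebra structures on `ULift (Fin n)`. -/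
structure FinAlgOn (n : ℕ) : Type u where
  mul : M.T (ULift.{u} (Fin n)) → ULift.{u} (Fin n)
  mul_unit : ∀ a, mul (M.unit a) = a
  mul_assoc : ∀ w, mul (M.mult w) = mul (M.map mul w)

/-- The algebra corresponding to a skeleton algebra. -/
def FinAlgOn.toAlg {M : SetMonad.{u}} {n : ℕ} (B : M.FinAlgOn n) : M.Alg where
  carrier := ULift.{u} (Fin n)
  mul := B.mul
  mul_unit := B.mul_unit
  mul_assoc := B.mul_assoc

/-- The multiplication of an algebra, viewed as a `T`-morphism from the free algebra on
its underlying set. -/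
theorem mulIsHom {n : ℕ} (B : M.FinAlgOn n) :
    M.IsHom (M.Free (ULift.{u} (Fin n))) B.toAlg B.mul :=
  fun w => B.mul_assoc w

/-- A `T`-morphism type over the algebra `A`: a compatible assignment of values to all
`T`-morphisms from `A` into finite `T`-algebras of the skeleton. The set of such types
is the compactification `Ā` of `A`. -/
structure MorphType (A : M.Alg) : Type u where
  app : ∀ (n : ℕ) (B : M.FinAlgOn n) (h : A.carrier → ULift.{u} (Fin n)),
    M.IsHom A B.toAlg h → ULift.{u} (Fin n)
  compat : ∀ (n m : ℕ) (B : M.FinAlgOn n) (C : M.FinAlgOn m)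
    (h : A.carrier → ULift.{u} (Fin n)) (hh : M.IsHom A B.toAlg h)
    (g : ULift.{u} (Fin n) → ULift.{u} (Fin m)) (hg : M.IsHom B.toAlg C.toAlg g),
    app m C (g ∘ h) (isHom_comp hh hg) = g (app n B h hh)

/-- The profinite monad on objects: `T̄ Σ` is the set of morphism types over the free
algebra `T Σ`. -/
def TBar (Sig : Type u) : Type u := M.MorphType (M.Free Sig)


/-- The topology on the compactification `Ā`, generated by the base sets
`h̄⁻¹({b})` for profinite extensions of morphisms into finite skeleton algebras. -/
def typeTopology (A : M.Alg) : TopologicalSpace (M.MorphType A) :=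
  TopologicalSpace.generateFrom
    {S | ∃ (n : ℕ) (B : M.FinAlgOn n) (h : A.carrier → ULift.{u} (Fin n))
        (hh : M.IsHom A B.toAlg h) (b : ULift.{u} (Fin n)),
        S = {τ : M.MorphType A | τ.app n B h hh = b}}

/-- The canonical map `ι_A : A → Ā` sending `a` to the type `h ↦ h(a)`. -/
def iota (A : M.Alg) (a : A.carrier) : M.MorphType A where
  app := fun _ _ h _ => h a
  compat := fun _ _ _ _ _ _ _ _ => rfl

end SetMonad

namespace SetMonad

open Filter Topology

variable {M : SetMonad.{u}}

/-- The binary product of two algebras. -/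
def Alg.prod (A B : M.Alg) : M.Alg where
  carrier := A.carrier × B.carrier
  mul w := (A.mul (M.map Prod.fst w), B.mul (M.map Prod.snd w))
  mul_unit a := by simp only [M.unit_nat, A.mul_unit, B.mul_unit]
  mul_assoc w := by
    simp only [M.mult_nat, A.mul_assoc, B.mul_assoc, ← M.map_comp]
    rfl

theorem isHom_fst (A B : M.Alg) : M.IsHom (A.prod B) A Prod.fst := fun _ => rfl

theorem isHom_snd (A B : M.Alg) : M.IsHom (A.prod B) B Prod.snd := fun _ => rfl

theorem isHom_prodMk {A B C : M.Alg} {f : A.carrier → B.carrier} {g : A.carrier → C.carrier}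
    (hf : M.IsHom A B f) (hg : M.IsHom A C g) :
    M.IsHom A (B.prod C) (fun a => (f a, g a)) := by
  intro w
  refine Prod.ext ?_ ?_
  · change f (A.mul w) = B.mul (M.map Prod.fst (M.map (fun a => (f a, g a)) w))
    rw [hf, ← M.map_comp]
    rfl
  · change g (A.mul w) = C.mul (M.map Prod.snd (M.map (fun a => (f a, g a)) w))
    rw [hg, ← M.map_comp]
    rfl

/-- The algebra structure pulled back along an injection whose image is closed under the
multiplication, as witnessed by `m`. -/
def Alg.pullback (B : M.Alg) {X : Type u} (i : X → B.carrier) (hi : Function.Injective i)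
    (m : M.T X → X) (hm : ∀ w, i (m w) = B.mul (M.map i w)) : M.Alg where
  carrier := X
  mul := m
  mul_unit a := hi (by rw [hm, M.unit_nat, B.mul_unit])
  mul_assoc w := hi (by
    rw [hm, hm, M.mult_nat, B.mul_assoc, ← M.map_comp, ← M.map_comp]
    exact congrArg (fun f => B.mul (M.map f w)) (funext fun v => (hm v).symm))

/-- A morphism into a finite algebra of the skeleton. -/
structure FinHom (A : M.Alg) : Type u where
  card : ℕ
  alg : M.FinAlgOn card
  toFun : A.carrier → ULift.{u} (Fin card)
  isHom : M.IsHom A alg.toAlg toFun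

/-- The profinite extension of a morphism, evaluated at a type. -/
def MorphType.eval {A : M.Alg} (τ : M.MorphType A) (p : FinHom A) : ULift.{u} (Fin p.card) :=
  τ.app p.card p.alg p.toFun p.isHom

theorem MorphType.eval_of_factor {A : M.Alg} (τ : M.MorphType A) (p r : FinHom A)
    {g : ULift.{u} (Fin r.card) → ULift.{u} (Fin p.card)}
    (hg : M.IsHom r.alg.toAlg p.alg.toAlg g) (h : ∀ a, p.toFun a = g (r.toFun a)) :
    τ.eval p = g (τ.eval r) := by
  obtain ⟨n, B, f, hf⟩ := p
  change ULift.{u} (Fin r.card) → ULift.{u} (Fin n) at g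
  obtain rfl : f = g ∘ r.toFun := funext h
  exact τ.compat _ _ r.alg B r.toFun r.isHom g hg

/-- Every morphism into a finite algebra factors surjectively through a morphism into a finite
algebra of the skeleton. -/
theorem exists_finHom_factor {A C : M.Alg} [Finite C.carrier] {k : A.carrier → C.carrier}
    (hk : M.IsHom A C k) :
    ∃ (r : FinHom A) (e : ULift.{u} (Fin r.card) → C.carrier),
      M.IsHom r.alg.toAlg C e ∧ (∀ a, k a = e (r.toFun a)) ∧ Function.Surjective r.toFun := by
  obtain ⟨n, ⟨φ⟩⟩ := Finite.exists_equiv_fin (Set.range k)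
  let ψ : Set.range k ≃ ULift.{u} (Fin n) := φ.trans Equiv.ulift.symm
  let q : A.carrier → ULift.{u} (Fin n) := fun a => ψ ⟨k a, a, rfl⟩
  let e : ULift.{u} (Fin n) → C.carrier := fun x => (ψ.symm x).1
  have he : Function.Injective e := Subtype.val_injective.comp ψ.symm.injective
  have heq : ∀ a, k a = e (q a) := fun a => by simp [e, q]
  have hq : Function.Surjective q := fun x => by
    obtain ⟨a, ha⟩ := (ψ.symm x).2
    exact ⟨a, he ((heq a).symm.trans ha)⟩
  obtain ⟨s, hs⟩ := hq.hasRightInverse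
  have hks : k ∘ s = e := funext fun x => by rw [Function.comp_apply, heq, hs]
  have hm : ∀ w, e (q (A.mul (M.map s w))) = C.mul (M.map e w) := fun w => by
    rw [← heq, hk, ← M.map_comp, hks]
  let D := C.pullback e he (fun w => q (A.mul (M.map s w))) hm
  refine ⟨⟨n, ⟨D.mul, D.mul_unit, D.mul_assoc⟩, q, fun w => he ?_⟩, e, hm, heq, hq⟩
  refine Eq.trans ?_ (hm (M.map q w)).symm
  rw [← heq, hk, ← M.map_comp]
  exact congrArg (fun f => C.mul (M.map f w)) (funext heq)

theorem finite_toAlg {n : ℕ} (B : M.FinAlgOn n) : Finite B.toAlg.carrier :=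
  inferInstanceAs (Finite (ULift.{u} (Fin n)))

theorem MorphType.eval_mem_range {A : M.Alg} (τ : M.MorphType A) (p : FinHom A) :
    ∃ a, p.toFun a = τ.eval p := by
  have := finite_toAlg p.alg
  obtain ⟨r, e, he, hfac, hr⟩ := exists_finHom_factor p.isHom
  obtain ⟨a, ha⟩ := hr (τ.eval r)
  exact ⟨a, by rw [τ.eval_of_factor p r he hfac, ← ha, hfac]⟩

theorem exists_finHom_pair {A : M.Alg} (p q : FinHom A) :
    ∃ (r : FinHom A) (f : ULift.{u} (Fin r.card) → ULift.{u} (Fin p.card))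
      (g : ULift.{u} (Fin r.card) → ULift.{u} (Fin q.card)),
      (∀ a, p.toFun a = f (r.toFun a)) ∧ (∀ a, q.toFun a = g (r.toFun a)) ∧
      ∀ τ : M.MorphType A, τ.eval p = f (τ.eval r) ∧ τ.eval q = g (τ.eval r) := by
  have : Finite (p.alg.toAlg.prod q.alg.toAlg).carrier :=
    inferInstanceAs (Finite (ULift.{u} (Fin p.card) × ULift.{u} (Fin q.card)))
  obtain ⟨r, e, he, hfac, -⟩ := exists_finHom_factor (isHom_prodMk p.isHom q.isHom)
  have hp : ∀ a, p.toFun a = (e (r.toFun a)).1 := fun a => congrArg Prod.fst (hfac a)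
  have hq : ∀ a, q.toFun a = (e (r.toFun a)).2 := fun a => congrArg Prod.snd (hfac a)
  exact ⟨r, fun x => (e x).1, fun x => (e x).2, hp, hq, fun τ =>
    ⟨τ.eval_of_factor p r (isHom_comp he (isHom_fst _ _)) hp,
      τ.eval_of_factor q r (isHom_comp he (isHom_snd _ _)) hq⟩⟩

instance (A : M.Alg) : Nonempty (FinHom A) :=
  ⟨⟨1, ⟨fun _ => default, fun _ => Subsingleton.elim _ _, fun _ => rfl⟩, fun _ => default,
    fun _ => rfl⟩⟩

attribute [local instance] typeTopology

theorem isOpen_eval_eq {A : M.Alg} (p : FinHom A) (b : ULift.{u} (Fin p.card)) :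
    IsOpen {τ : M.MorphType A | τ.eval p = b} :=
  TopologicalSpace.isOpen_generateFrom_of_mem ⟨_, p.alg, p.toFun, p.isHom, b, rfl⟩

theorem isOpen_eval_mem {A : M.Alg} (p : FinHom A) (F : Set (ULift.{u} (Fin p.card))) :
    IsOpen {τ : M.MorphType A | τ.eval p ∈ F} := by
  have : {τ : M.MorphType A | τ.eval p ∈ F} = ⋃ b ∈ F, {τ | τ.eval p = b} := by
    ext τ
    simp
  rw [this]
  exact isOpen_biUnion fun b _ => isOpen_eval_eq p b

theorem isClopen_eval_mem {A : M.Alg} (p : FinHom A) (F : Set (ULift.{u} (Fin p.card))) :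
    IsClopen {τ : M.MorphType A | τ.eval p ∈ F} :=
  ⟨⟨isOpen_eval_mem p Fᶜ⟩, isOpen_eval_mem p F⟩

/-- The base sets form a neighbourhood base at each type. -/
theorem exists_eval_subset_of_isOpen {A : M.Alg} {U : Set (M.MorphType A)} (hU : IsOpen U)
    {τ : M.MorphType A} (hτ : τ ∈ U) :
    ∃ p : FinHom A, {σ : M.MorphType A | σ.eval p = τ.eval p} ⊆ U := by
  induction hU with
  | basic U hU =>
    obtain ⟨n, B, h, hh, b, rfl⟩ := hU
    exact ⟨⟨n, B, h, hh⟩, fun σ hσ => Eq.trans hσ hτ⟩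
  | univ => exact ⟨Classical.arbitrary _, Set.subset_univ _⟩
  | inter U V _ _ ihU ihV =>
    obtain ⟨p, hp⟩ := ihU hτ.1
    obtain ⟨q, hq⟩ := ihV hτ.2
    obtain ⟨r, f, g, -, -, hr⟩ := exists_finHom_pair p q
    refine ⟨r, fun σ (hσ : _ = _) => ⟨hp ?_, hq ?_⟩⟩
    · change σ.eval p = τ.eval p
      rw [(hr σ).1, (hr τ).1, hσ]
    · change σ.eval q = τ.eval q
      rw [(hr σ).2, (hr τ).2, hσ]
  | sUnion 𝒰 _ ih =>
    obtain ⟨U, hU, hτU⟩ := hτ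
    obtain ⟨p, hp⟩ := ih U hU hτU
    exact ⟨p, hp.trans (Set.subset_sUnion_of_mem hU)⟩

instance (A : M.Alg) : CompactSpace (M.MorphType A) := by
  refine ⟨isCompact_iff_ultrafilter_le_nhds.2 fun 𝒰 _ => ?_⟩
  have key : ∀ p : FinHom A, ∃ b, ∀ᶠ σ in 𝒰, MorphType.eval σ p = b := fun p => by
    have h := (Ultrafilter.finite_biUnion_mem_iff (f := 𝒰)
      (Set.finite_univ (α := ULift.{u} (Fin p.card)))
      (s := fun b => {σ : M.MorphType A | σ.eval p = b})).1
      (Filter.mem_of_superset Filter.univ_mem fun σ _ => by simp)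
    obtain ⟨b, -, hb⟩ := h
    exact ⟨b, hb⟩
  choose v hv using key
  let τ : M.MorphType A :=
    { app := fun n B h hh => v ⟨n, B, h, hh⟩
      compat := fun n m B C h hh g hg => by
        obtain ⟨σ, h₁, h₂⟩ :=
          ((hv ⟨n, B, h, hh⟩).and (hv ⟨m, C, g ∘ h, isHom_comp hh hg⟩)).exists
        rw [← h₁, ← h₂]
        exact σ.compat n m B C h hh g hg }
  refine ⟨τ, Set.mem_univ _, fun U hU => ?_⟩
  obtain ⟨V, hVU, hV, hτV⟩ := mem_nhds_iff.1 hU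
  obtain ⟨p, hp⟩ := exists_eval_subset_of_isOpen hV hτV
  exact Filter.mem_of_superset (hv p) (hp.trans hVU)

/-- The closure of a recognisable set consists of the types whose value is accepted. -/
theorem closure_iota_preimage {A : M.Alg} (p : FinHom A) (F : Set (ULift.{u} (Fin p.card))) :
    closure (M.iota A '' (p.toFun ⁻¹' F)) = {τ : M.MorphType A | τ.eval p ∈ F} := by
  refine Set.Subset.antisymm (closure_minimal ?_ (isClopen_eval_mem p F).isClosed) ?_
  · rintro _ ⟨a, ha, rfl⟩
    exact ha
  · intro τ hτ
    refine mem_closure_iff.2 fun U hU hτU => ?_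
    obtain ⟨q, hq⟩ := exists_eval_subset_of_isOpen hU hτU
    obtain ⟨r, f, g, hf, hg, hr⟩ := exists_finHom_pair p q
    obtain ⟨a, ha⟩ := τ.eval_mem_range r
    refine ⟨M.iota A a, hq ?_, a, ?_, rfl⟩
    · change q.toFun a = τ.eval q
      rw [hg, ha, (hr τ).2]
    · rw [Set.mem_preimage, hf, ha, ← (hr τ).1]
      exact hτ

/-- A clopen set of types is determined by the values at a single morphism. -/
theorem exists_eval_mem_of_isClopen {A : M.Alg} {S : Set (M.MorphType A)} (hS : IsClopen S) :
    ∃ (p : FinHom A) (F : Set (ULift.{u} (Fin p.card))), S = {τ | τ.eval p ∈ F} := by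
  suffices h : ∃ (p : FinHom A) (F : Set (ULift.{u} (Fin p.card))),
      S ⊆ {τ | τ.eval p ∈ F} ∧ {τ | τ.eval p ∈ F} ⊆ S by
    obtain ⟨p, F, h₁, h₂⟩ := h
    exact ⟨p, F, h₁.antisymm h₂⟩
  refine hS.isClosed.isCompact.induction_on
    (p := fun U => ∃ (p : FinHom A) (F : Set (ULift.{u} (Fin p.card))),
      U ⊆ {τ | τ.eval p ∈ F} ∧ {τ | τ.eval p ∈ F} ⊆ S) ?_ ?_ ?_ ?_
  · exact ⟨Classical.arbitrary _, ∅, Set.empty_subset _, fun _ h => h.elim⟩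
  · rintro U V hUV ⟨p, F, h₁, h₂⟩
    exact ⟨p, F, hUV.trans h₁, h₂⟩
  · rintro U V ⟨p, F, hU, hF⟩ ⟨q, G, hV, hG⟩
    obtain ⟨r, f, g, -, -, hr⟩ := exists_finHom_pair p q
    have : {τ : M.MorphType A | τ.eval r ∈ f ⁻¹' F ∪ g ⁻¹' G} =
        {τ | τ.eval p ∈ F} ∪ {τ | τ.eval q ∈ G} := by
      ext τ
      simp [(hr τ).1, (hr τ).2]
    refine ⟨r, f ⁻¹' F ∪ g ⁻¹' G, ?_⟩
    rw [this]
    exact ⟨Set.union_subset_union hU hV, Set.union_subset hF hG⟩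
  · intro τ hτ
    obtain ⟨p, hp⟩ := exists_eval_subset_of_isOpen hS.isOpen hτ
    exact ⟨_, mem_nhdsWithin_of_mem_nhds ((isOpen_eval_eq p _).mem_nhds rfl), p, {τ.eval p},
      subset_rfl, hp⟩

end SetMonad

/-- **Clopen sets of the compactification.** A subset of `Ā` is clopen if and only if it
is the closure of the image under `ι_A` of a recognisable subset of `A`. -/
theorem clopen_iff_closure_of_recognisable (M : SetMonad.{u}) (A : M.Alg)
    (S : Set (M.MorphType A)) :
    @IsClopen (M.MorphType A) (M.typeTopology A) S ↔
      ∃ (n : ℕ) (B : M.FinAlgOn n) (h : A.carrier → ULift.{u} (Fin n))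
        (_ : M.IsHom A B.toAlg h) (F : Set (ULift.{u} (Fin n))),
        S = @closure (M.MorphType A) (M.typeTopology A) (M.iota A '' (h ⁻¹' F)) := by
  constructor
  · intro hS
    obtain ⟨p, F, rfl⟩ := SetMonad.exists_eval_mem_of_isClopen hS
    exact ⟨p.card, p.alg, p.toFun, p.isHom, F, (SetMonad.closure_iota_preimage p F).symm⟩
  · rintro ⟨n, B, h, hh, F, rfl⟩
    rw [SetMonad.closure_iota_preimage ⟨n, B, h, hh⟩ F]
    exact SetMonad.isClopen_eval_mem ⟨n, B, h, hh⟩ F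
end
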